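/- Fix an integer r ≥ 1 and p ∈ (0,1). The average position of the r-th weak left-to-right maximum in a random word of length n with i.i.d. geometric(p) letters — that is, the conditional expectation of the position of the r-th weak left-to-right maximum given that the word has at least r weak left-to-right maxima — equals (1/(r−1)!) · ( p · log_Q n )^{r−1} + O( (log n)^{r−2} ) as n → ∞: there exist constants C > 0 and N such that the conditional expectation differs from (1/(r−1)!) ( p log_Q n )^{r−1} by at most C (log n)^{r−2} for all n ≥ N. Here Q = 1/q and log_Q n = (log n)/(log Q). -/

import Mathlib

open scoped BigOperators

/-- Geometric(p) weight of a letter `k ∈ ℕ`: `P(X = k) = p (1-p)^(k-1)` for `k ≥ 1`,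
and `0` otherwise (letters take values in `{1, 2, 3, …}`). -/
noncomputable def geomWt (p : ℝ) (k : ℕ) : ℝ := if 1 ≤ k then p * (1 - p) ^ (k - 1) else 0

/-- Probability of the word `w` of length `n` under i.i.d. geometric(p) letters. -/
noncomputable def wordWt (p : ℝ) {n : ℕ} (w : Fin n → ℕ) : ℝ := ∏ j, geomWt p (w j)

/-- The set of (positions of) weak left-to-right maxima of the word `w`:
indices `j` with `w i ≤ w j` for all `i < j`. -/
def weakLTRMaxSet {n : ℕ} (w : Fin n → ℕ) : Finset (Fin n) :=
  Finset.univ.filter (fun j => ∀ i, i < j → w i ≤ w j)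

/-- The (1-based) position of the `r`-th weak left-to-right maximum of `w`
(junk value `0` if there are fewer than `r` of them). -/
def weakLTRMaxPos {n : ℕ} (w : Fin n → ℕ) (r : ℕ) : ℕ :=
  (((weakLTRMaxSet w).sort (· ≤ ·)).map (fun j => (j : ℕ) + 1)).getD (r - 1) 0

/-- The value (letter) of the `r`-th weak left-to-right maximum of `w`
(junk value `0` if there are fewer than `r` of them). -/
def weakLTRMaxVal {n : ℕ} (w : Fin n → ℕ) (r : ℕ) : ℕ :=
  (((weakLTRMaxSet w).sort (· ≤ ·)).map w).getD (r - 1) 0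

/-- The expected number of nonempty prefixes of an infinite geometric word that have `s + 1` weak
left-to-right maxima and largest letter `k + 1`. -/
noncomputable def recMass (p : ℝ) : ℕ → ℕ → ℝ
  | 0, _ => p
  | s + 1, k => p * ∑ u ∈ Finset.range (k + 1), recMass p s u

/-- The part of `recMass` that comes from the prefixes of length greater than `m`. -/
noncomputable def recTail (p : ℝ) : ℕ → ℕ → ℕ → ℝ
  | 0, s, k => recMass p s k
  | m + 1, 0, k => (1 - (1 - p) ^ k) * recTail p m 0 k
  | m + 1, s + 1, k => (1 - (1 - p) ^ k) * recTail p m (s + 1) k +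
      p * (1 - p) ^ k * ∑ u ∈ Finset.range (k + 1), recTail p m s u

section Analysis

variable {p : ℝ}

lemma recMass_nonneg (hp0 : 0 < p) (s k : ℕ) : 0 ≤ recMass p s k := by
  induction s generalizing k with
  | zero => exact hp0.le
  | succ s ih => exact mul_nonneg hp0.le (Finset.sum_nonneg fun u _ => ih u)

lemma recMass_le (hp0 : 0 < p) (hp1 : p < 1) (s k : ℕ) : recMass p s k ≤ ((k : ℝ) + 1) ^ s := by
  induction s generalizing k with
  | zero => simpa [recMass] using hp1.le
  | succ s ih =>
    have h : ∑ u ∈ Finset.range (k + 1), recMass p s u ≤ ((k : ℝ) + 1) ^ (s + 1) := by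
      calc ∑ u ∈ Finset.range (k + 1), recMass p s u
          ≤ ∑ u ∈ Finset.range (k + 1), ((k : ℝ) + 1) ^ s := by
            refine Finset.sum_le_sum fun u hu => (ih u).trans ?_
            have : (u : ℝ) ≤ k := by exact_mod_cast Finset.mem_range_succ_iff.1 hu
            gcongr
        _ = _ := by simp [pow_succ]; ring
    have h0 : 0 ≤ ∑ u ∈ Finset.range (k + 1), recMass p s u :=
      Finset.sum_nonneg fun u _ => recMass_nonneg hp0 s u
    simp only [recMass]
    nlinarith

lemma sum_recMass (s K : ℕ) :
    ∑ k ∈ Finset.range K, recMass p s k =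
      p ^ (s + 1) * ((K.ascFactorial (s + 1) : ℕ) : ℝ) / ((s + 1).factorial : ℝ) := by
  have h : ∀ s K : ℕ, ∑ k ∈ Finset.range K, recMass p s k =
      p ^ (s + 1) * ((K + s).choose (s + 1) : ℕ) := by
    intro s
    induction s with
    | zero => intro K; simp [recMass]; ring
    | succ s ih =>
      intro K
      induction K with
      | zero => simp
      | succ K ihK =>
        rw [Finset.sum_range_succ, ihK]
        simp only [recMass]
        rw [ih, show K + 1 + (s + 1) = (K + 1 + s) + 1 by ring, Nat.choose_succ_succ,
          show K + (s + 1) = K + 1 + s by ring]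
        push_cast
        ring
  rw [h, show K + s = K + (s + 1) - 1 by omega, Nat.choose_eq_asc_factorial_div_factorial']
  rw [Nat.cast_div (Nat.factorial_dvd_ascFactorial _ _) (by positivity)]
  ring

lemma one_sub_pow_bounds (hp0 : 0 < p) (hp1 : p < 1) (k : ℕ) :
    0 < (1 - p) ^ k ∧ (1 - p) ^ k ≤ 1 :=
  ⟨pow_pos (by linarith) k, pow_le_one₀ (by linarith) (by linarith)⟩

lemma recTail_nonneg (hp0 : 0 < p) (hp1 : p < 1) (m s k : ℕ) : 0 ≤ recTail p m s k := by
  induction m generalizing s k with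
  | zero => exact recMass_nonneg hp0 s k
  | succ m ih =>
    obtain ⟨h1, h2⟩ := one_sub_pow_bounds hp0 hp1 k
    cases s with
    | zero => exact mul_nonneg (by linarith) (ih _ _)
    | succ s =>
      exact add_nonneg (mul_nonneg (by linarith) (ih _ _))
        (mul_nonneg (by positivity) (Finset.sum_nonneg fun u _ => ih _ _))

lemma recTail_sub_succ_le (hp0 : 0 < p) (hp1 : p < 1) (m s k : ℕ) :
    recTail p m s k - recTail p (m + 1) s k ≤ (1 - p) ^ k * recTail p m s k := by
  obtain ⟨h1, h2⟩ := one_sub_pow_bounds hp0 hp1 k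
  cases s with
  | zero => simp only [recTail]; linarith
  | succ s =>
    have : 0 ≤ p * (1 - p) ^ k * ∑ u ∈ Finset.range (k + 1), recTail p m s u :=
      mul_nonneg (by positivity) (Finset.sum_nonneg fun u _ => recTail_nonneg hp0 hp1 _ _ _)
    simp only [recTail]; linarith

/-- The first difference of `recTail`. By `jointProb_eq_recProb`, it is the probability that a word
of length `m + 1` has `s + 1` weak left-to-right maxima and largest letter `k + 1`. -/
noncomputable def recProb (p : ℝ) (m s k : ℕ) : ℝ := recTail p m s k - recTail p (m + 1) s k

lemma recProb_zero_zero (k : ℕ) : recProb p 0 0 k = p * (1 - p) ^ k := by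
  simp only [recProb, recTail, recMass]; ring

lemma recProb_zero_succ (s k : ℕ) : recProb p 0 (s + 1) k = 0 := by
  simp only [recProb, recTail, recMass]; ring

lemma recProb_succ_zero (m k : ℕ) :
    recProb p (m + 1) 0 k = (1 - (1 - p) ^ k) * recProb p m 0 k := by
  simp only [recProb, recTail]; ring

lemma recProb_succ_succ (m s k : ℕ) :
    recProb p (m + 1) (s + 1) k = (1 - (1 - p) ^ k) * recProb p m (s + 1) k +
      p * (1 - p) ^ k * ∑ u ∈ Finset.range (k + 1), recProb p m s u := by
  have h : ∀ m, recTail p (m + 1) (s + 1) k = (1 - (1 - p) ^ k) * recTail p m (s + 1) k +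
      p * (1 - p) ^ k * ∑ u ∈ Finset.range (k + 1), recTail p m s u := fun _ => rfl
  simp only [recProb, Finset.sum_sub_distrib]
  linear_combination h m - h (m + 1)

lemma recProb_nonneg (hp0 : 0 < p) (hp1 : p < 1) (m s k : ℕ) : 0 ≤ recProb p m s k := by
  induction m generalizing s k with
  | zero =>
    cases s with
    | zero =>
      rw [recProb_zero_zero]
      exact mul_nonneg hp0.le (one_sub_pow_bounds hp0 hp1 k).1.le
    | succ s => rw [recProb_zero_succ]
  | succ m ih =>
    obtain ⟨h1, h2⟩ := one_sub_pow_bounds hp0 hp1 k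
    cases s with
    | zero => rw [recProb_succ_zero]; exact mul_nonneg (by linarith) (ih _ _)
    | succ s =>
      rw [recProb_succ_succ]
      exact add_nonneg (mul_nonneg (by linarith) (ih _ _))
        (mul_nonneg (by positivity) (Finset.sum_nonneg fun u _ => ih _ _))

lemma sum_recProb (m s k : ℕ) :
    ∑ j ∈ Finset.range m, recProb p j s k = recMass p s k - recTail p m s k := by
  simp only [recProb]
  rw [Finset.sum_range_sub']
  rfl

lemma recTail_le_recMass (hp0 : 0 < p) (hp1 : p < 1) (m s k : ℕ) :
    recTail p m s k ≤ recMass p s k := by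
  have := Finset.sum_nonneg fun j (_ : j ∈ Finset.range m) => recProb_nonneg hp0 hp1 j s k
  rw [sum_recProb] at this
  linarith

lemma recProb_le (hp0 : 0 < p) (hp1 : p < 1) (m s k : ℕ) :
    recProb p m s k ≤ (1 - p) ^ k * ((k : ℝ) + 1) ^ s :=
  (recTail_sub_succ_le hp0 hp1 m s k).trans
    (mul_le_mul_of_nonneg_left
      ((recTail_le_recMass hp0 hp1 m s k).trans (recMass_le hp0 hp1 s k))
      (one_sub_pow_bounds hp0 hp1 k).1.le)

lemma recMass_sub_recTail_le (hp0 : 0 < p) (hp1 : p < 1) (m s k : ℕ) :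
    recMass p s k - recTail p m s k ≤ m * ((1 - p) ^ k * ((k : ℝ) + 1) ^ s) := by
  rw [← sum_recProb]
  refine (Finset.sum_le_sum fun j _ => recProb_le hp0 hp1 j s k).trans ?_
  simp

lemma mul_sum_inv_pow_le (hp1 : p < 1) (k : ℕ) :
    p * ∑ u ∈ Finset.range k, ((1 - p)⁻¹) ^ u ≤ (1 - p) * ((1 - p)⁻¹) ^ k := by
  have hq : 0 < 1 - p := by linarith
  induction k with
  | zero => simpa using hp1.le
  | succ k ih =>
    rw [Finset.sum_range_succ, mul_add, pow_succ]
    have : (1 - p) * (((1 - p)⁻¹) ^ k * (1 - p)⁻¹) = ((1 - p)⁻¹) ^ k := by field_simp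
    rw [this]
    linarith

lemma mul_sum_inv_pow_succ_le (hp1 : p < 1) (k : ℕ) :
    p * ∑ u ∈ Finset.range (k + 1), ((1 - p)⁻¹) ^ u ≤ ((1 - p)⁻¹) ^ k := by
  have hq : 0 < 1 - p := by linarith
  refine (mul_sum_inv_pow_le hp1 (k + 1)).trans_eq ?_
  rw [pow_succ]; field_simp

/-- One step of the recursion for `recTail` turns growth of order `Q ^ (k * (i + 1))` into growth of
order `Q ^ (k * i)`, at the cost of one more polynomial factor. -/
lemma weighted_sum_le (hp0 : 0 < p) (hp1 : p < 1) (i s k : ℕ) {c : ℝ} (hc : 0 ≤ c) {g : ℕ → ℝ}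
    (hg : ∀ u, g u ≤ c * ((u : ℝ) + 1) ^ s * ((1 - p)⁻¹) ^ (u * (i + 1))) :
    p * (1 - p) ^ k * ∑ u ∈ Finset.range (k + 1), g u ≤
      c * ((k : ℝ) + 1) ^ (s + 1) * ((1 - p)⁻¹) ^ (k * i) := by
  have hq : 0 < 1 - p := by linarith
  have hQ : 1 ≤ (1 - p)⁻¹ := (one_le_inv₀ hq).2 (by linarith)
  have hsum : ∑ u ∈ Finset.range (k + 1), g u ≤
      c * ((k : ℝ) + 1) ^ s * ((1 - p)⁻¹) ^ (k * i) *
        ∑ u ∈ Finset.range (k + 1), ((1 - p)⁻¹) ^ u := by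
    rw [Finset.mul_sum]
    refine Finset.sum_le_sum fun u hu => (hg u).trans ?_
    have h1 : u ≤ k := Finset.mem_range_succ_iff.1 hu
    have h2 : (u : ℝ) ≤ k := by exact_mod_cast h1
    rw [show u * (i + 1) = u * i + u by ring, pow_add, ← mul_assoc]
    have h3 : ((1 - p)⁻¹) ^ (u * i) ≤ ((1 - p)⁻¹) ^ (k * i) :=
      pow_le_pow_right₀ hQ (Nat.mul_le_mul_right _ h1)
    gcongr
  calc p * (1 - p) ^ k * ∑ u ∈ Finset.range (k + 1), g u
      ≤ p * (1 - p) ^ k * (c * ((k : ℝ) + 1) ^ s * ((1 - p)⁻¹) ^ (k * i) *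
        ∑ u ∈ Finset.range (k + 1), ((1 - p)⁻¹) ^ u) := by gcongr
    _ = (1 - p) ^ k * (c * ((k : ℝ) + 1) ^ s * ((1 - p)⁻¹) ^ (k * i)) *
        (p * ∑ u ∈ Finset.range (k + 1), ((1 - p)⁻¹) ^ u) := by ring
    _ ≤ (1 - p) ^ k * (c * ((k : ℝ) + 1) ^ s * ((1 - p)⁻¹) ^ (k * i)) * ((1 - p)⁻¹) ^ k := by
        gcongr; exact mul_sum_inv_pow_succ_le hp1 k
    _ = c * ((k : ℝ) + 1) ^ s * ((1 - p)⁻¹) ^ (k * i) * ((1 - p) * (1 - p)⁻¹) ^ k := by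
        rw [mul_pow]; ring
    _ = c * ((k : ℝ) + 1) ^ s * ((1 - p)⁻¹) ^ (k * i) := by
        rw [mul_inv_cancel₀ hq.ne', one_pow, mul_one]
    _ ≤ c * ((k : ℝ) + 1) ^ (s + 1) * ((1 - p)⁻¹) ^ (k * i) := by
        have : ((k : ℝ) + 1) ^ s ≤ ((k : ℝ) + 1) ^ (s + 1) :=
          pow_le_pow_right₀ (by linarith [(Nat.cast_nonneg k : (0 : ℝ) ≤ k)]) (Nat.le_succ s)
        gcongr

lemma mul_recTail_le (hp0 : 0 < p) (hp1 : p < 1) (m s k : ℕ) :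
    m * recTail p m s k ≤ (s + 1) * ((k : ℝ) + 1) ^ s * ((1 - p)⁻¹) ^ k := by
  have hq : 0 < 1 - p := by linarith
  induction m generalizing s k with
  | zero => simp only [Nat.cast_zero, zero_mul]; positivity
  | succ m ih =>
    obtain ⟨h1, h2⟩ := one_sub_pow_bounds hp0 hp1 k
    have hx : (1 - p) ^ k * ((1 - p)⁻¹) ^ k = 1 := by
      rw [← mul_pow, mul_inv_cancel₀ hq.ne', one_pow]
    have hM := (recTail_le_recMass hp0 hp1 (m + 1) s k).trans (recMass_le hp0 hp1 s k)
    have hI := mul_le_mul_of_nonneg_left (ih s k) (by linarith : 0 ≤ 1 - (1 - p) ^ k)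
    cases s with
    | zero =>
      have e : ((m + 1 : ℕ) : ℝ) * recTail p (m + 1) 0 k =
          (1 - (1 - p) ^ k) * (m * recTail p m 0 k) + recTail p (m + 1) 0 k := by
        push_cast; simp only [recTail]; ring
      rw [e]
      simp only [pow_zero, Nat.cast_zero] at hI hM ⊢
      linarith
    | succ s =>
      have hW := weighted_sum_le hp0 hp1 0 s k (c := s + 1) (by positivity)
        (g := fun u => m * recTail p m s u) (fun u => by simpa using ih s u)
      have e : ((m + 1 : ℕ) : ℝ) * recTail p (m + 1) (s + 1) k =
          (1 - (1 - p) ^ k) * (m * recTail p m (s + 1) k) +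
          p * (1 - p) ^ k * (∑ u ∈ Finset.range (k + 1), m * recTail p m s u) +
          recTail p (m + 1) (s + 1) k := by
        rw [← Finset.mul_sum]; push_cast; simp only [recTail]; ring
      rw [e]
      simp only [mul_zero, pow_zero, mul_one] at hW
      have hz : (1 - (1 - p) ^ k) * (((s + 1 : ℕ) + 1) * ((k : ℝ) + 1) ^ (s + 1) *
          ((1 - p)⁻¹) ^ k) = ((s + 1 : ℕ) + 1) * ((k : ℝ) + 1) ^ (s + 1) * ((1 - p)⁻¹) ^ k -
          ((s + 1 : ℕ) + 1) * ((k : ℝ) + 1) ^ (s + 1) := by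
        linear_combination (-(((s + 1 : ℕ) : ℝ) + 1) * ((k : ℝ) + 1) ^ (s + 1)) * hx
      rw [hz] at hI
      push_cast at hI ⊢
      linarith

lemma sq_mul_recTail_le (hp0 : 0 < p) (hp1 : p < 1) (m s k : ℕ) :
    (m : ℝ) ^ 2 * recTail p m s k ≤
      (s + 1) * (s + 2) * ((k : ℝ) + 1) ^ s * ((1 - p)⁻¹) ^ (k * 2) := by
  have hq : 0 < 1 - p := by linarith
  induction m generalizing s k with
  | zero => simp only [Nat.cast_zero]; rw [zero_pow two_ne_zero, zero_mul]; positivity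
  | succ m ih =>
    obtain ⟨h1, h2⟩ := one_sub_pow_bounds hp0 hp1 k
    have hx : (1 - p) ^ k * ((1 - p)⁻¹) ^ (k * 2) = ((1 - p)⁻¹) ^ k := by
      rw [mul_two, pow_add, ← mul_assoc, ← mul_pow, mul_inv_cancel₀ hq.ne', one_pow, one_mul]
    have hM := mul_recTail_le hp0 hp1 (m + 1) s k
    have hN := recTail_nonneg hp0 hp1 (m + 1) s k
    have hI := mul_le_mul_of_nonneg_left (ih s k) (by linarith : 0 ≤ 1 - (1 - p) ^ k)
    have hz : (1 - (1 - p) ^ k) * (((s : ℝ) + 1) * (s + 2) * ((k : ℝ) + 1) ^ s *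
          ((1 - p)⁻¹) ^ (k * 2)) =
        (s + 1) * (s + 2) * ((k : ℝ) + 1) ^ s * ((1 - p)⁻¹) ^ (k * 2) -
          (s + 1) * (s + 2) * ((k : ℝ) + 1) ^ s * ((1 - p)⁻¹) ^ k := by
      linear_combination (-((s : ℝ) + 1) * (s + 2) * ((k : ℝ) + 1) ^ s) * hx
    rw [hz] at hI
    cases s with
    | zero =>
      have e : ((m + 1 : ℕ) : ℝ) ^ 2 * recTail p (m + 1) 0 k =
          (1 - (1 - p) ^ k) * (m ^ 2 * recTail p m 0 k) +
            (2 * m + 1) * recTail p (m + 1) 0 k := by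
        push_cast; simp only [recTail]; ring
      rw [e]
      push_cast at hI hM ⊢
      simp only [pow_zero] at hI hM ⊢
      linarith
    | succ s =>
      have hW := weighted_sum_le hp0 hp1 1 s k (c := (s + 1) * (s + 2)) (by positivity)
        (g := fun u => m ^ 2 * recTail p m s u) (fun u => by simpa using ih s u)
      have e : ((m + 1 : ℕ) : ℝ) ^ 2 * recTail p (m + 1) (s + 1) k =
          (1 - (1 - p) ^ k) * (m ^ 2 * recTail p m (s + 1) k) +
          p * (1 - p) ^ k * (∑ u ∈ Finset.range (k + 1), m ^ 2 * recTail p m s u) +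
          (2 * m + 1) * recTail p (m + 1) (s + 1) k := by
        rw [← Finset.mul_sum]; push_cast; simp only [recTail]; ring
      rw [e]
      simp only [mul_one] at hW
      push_cast at hI hM ⊢
      linarith

lemma summable_pow_mul_add_one_pow (hp0 : 0 < p) (hp1 : p < 1) (s : ℕ) :
    Summable fun j : ℕ => (1 - p) ^ j * ((j : ℝ) + 1) ^ s := by
  have hq : 0 < 1 - p := by linarith
  have h := summable_pow_mul_geometric_of_norm_lt_one s (r := 1 - p)
    (by rw [Real.norm_of_nonneg hq.le]; linarith)
  have h2 := ((summable_nat_add_iff 1).2 h).mul_left (1 - p)⁻¹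
  refine h2.congr fun j => ?_
  push_cast
  rw [pow_succ]
  field_simp

lemma summable_of_le_geometric (hp0 : 0 < p) (hp1 : p < 1) (s : ℕ) {B : ℝ} {g : ℕ → ℝ}
    (h0 : ∀ k, 0 ≤ g k) (h1 : ∀ k, g k ≤ B * ((1 - p) ^ k * ((k : ℝ) + 1) ^ s)) : Summable g :=
  Summable.of_nonneg_of_le h0 h1 ((summable_pow_mul_add_one_pow hp0 hp1 s).mul_left B)

lemma tsum_shift_le (hp0 : 0 < p) (hp1 : p < 1) (s K : ℕ) {B : ℝ} (hB : 0 ≤ B) {g : ℕ → ℝ}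
    (h0 : ∀ k, 0 ≤ g k) (h1 : ∀ k, g k ≤ B * ((1 - p) ^ k * ((k : ℝ) + 1) ^ s)) :
    ∑' j, g (j + K) ≤ B * (1 - p) ^ K * ((K : ℝ) + 1) ^ s *
      ∑' j : ℕ, (1 - p) ^ j * ((j : ℝ) + 1) ^ s := by
  have hq : 0 < 1 - p := by linarith
  rw [← tsum_mul_left]
  refine Summable.tsum_le_tsum (fun j => (h1 _).trans ?_)
    ((summable_nat_add_iff K).2 (summable_of_le_geometric hp0 hp1 s h0 h1))
    ((summable_pow_mul_add_one_pow hp0 hp1 s).mul_left _)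
  have h2 : (((j + K : ℕ) : ℝ) + 1) ^ s ≤ (((K : ℝ) + 1) * ((j : ℝ) + 1)) ^ s := by
    have hj : (0 : ℝ) ≤ j := Nat.cast_nonneg j
    have hK : (0 : ℝ) ≤ K := Nat.cast_nonneg K
    push_cast
    gcongr
    nlinarith
  calc B * ((1 - p) ^ (j + K) * (((j + K : ℕ) : ℝ) + 1) ^ s)
      ≤ B * ((1 - p) ^ (j + K) * (((K : ℝ) + 1) * ((j : ℝ) + 1)) ^ s) := by gcongr
    _ = _ := by rw [pow_add, mul_pow]; ring

lemma recMass_sub_recTail_bounds (hp0 : 0 < p) (hp1 : p < 1) (m s : ℕ) :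
    (∀ k, 0 ≤ recMass p s k - recTail p m s k) ∧
    (∀ k, recMass p s k - recTail p m s k ≤ (m + 1) * ((1 - p) ^ k * ((k : ℝ) + 1) ^ s)) := by
  have hq : 0 < 1 - p := by linarith
  refine ⟨fun k => sub_nonneg.2 (recTail_le_recMass hp0 hp1 m s k), fun k =>
    (recMass_sub_recTail_le hp0 hp1 m s k).trans ?_⟩
  gcongr
  linarith

lemma summable_recProb (hp0 : 0 < p) (hp1 : p < 1) (m s : ℕ) : Summable (recProb p m s) :=
  summable_of_le_geometric hp0 hp1 s (B := 1) (recProb_nonneg hp0 hp1 m s)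
    fun k => by simpa using recProb_le hp0 hp1 m s k

lemma sum_tsum_recProb (hp0 : 0 < p) (hp1 : p < 1) (m s : ℕ) :
    ∑ j ∈ Finset.range m, ∑' k, recProb p j s k = ∑' k, (recMass p s k - recTail p m s k) := by
  rw [← Summable.tsum_finsetSum fun j _ => summable_recProb hp0 hp1 j s]
  exact tsum_congr fun k => sum_recProb m s k

/-- Up to `O((K + 1) ^ s)`, the total over all `k` of `recMass - recTail` is the total of `recMass`
over `k < K`, where `K` is the integer part of the logarithm of `m + 1`. -/
lemma exists_bound_tsum (hp0 : 0 < p) (hp1 : p < 1) (s : ℕ) :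
    ∃ C : ℝ, 0 ≤ C ∧ ∀ m K : ℕ, 1 ≤ m → ((1 - p)⁻¹) ^ K ≤ (m : ℝ) + 1 →
      (m : ℝ) + 1 ≤ ((1 - p)⁻¹) ^ (K + 1) →
      |∑' k, (recMass p s k - recTail p m s k) - ∑ k ∈ Finset.range K, recMass p s k| ≤
        C * ((K : ℝ) + 1) ^ s ∧
      ((m : ℝ) + 1) * ∑' k, recProb p m s k ≤ C * ((K : ℝ) + 1) ^ s := by
  have hq : 0 < 1 - p := by linarith
  set Θ : ℝ := ∑' j : ℕ, (1 - p) ^ j * ((j : ℝ) + 1) ^ s with hΘ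
  have hΘ0 : 0 ≤ Θ := tsum_nonneg fun j => by positivity
  refine ⟨(1 - p)⁻¹ * Θ + 4 * ((s + 1) * (s + 2)) / p, by positivity, ?_⟩
  intro m K hm hK1 hK2
  have hm' : (1 : ℝ) ≤ m := by exact_mod_cast hm
  have hmq : ((m : ℝ) + 1) * (1 - p) ^ K ≤ (1 - p)⁻¹ := by
    calc ((m : ℝ) + 1) * (1 - p) ^ K ≤ ((1 - p)⁻¹) ^ (K + 1) * (1 - p) ^ K := by gcongr
      _ = (1 - p)⁻¹ := by
        rw [pow_succ, mul_right_comm, ← mul_pow, inv_mul_cancel₀ hq.ne', one_pow, one_mul]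
  have hgeo : ∑ k ∈ Finset.range K, ((1 - p)⁻¹) ^ k ≤ ((m : ℝ) + 1) / p := by
    rw [le_div_iff₀' hp0]
    refine (mul_sum_inv_pow_le hp1 K).trans ?_
    have : 0 ≤ ((1 - p)⁻¹) ^ K := by positivity
    nlinarith
  have htail : ∀ g : ℕ → ℝ, (∀ k, 0 ≤ g k) →
      (∀ k, g k ≤ (m + 1) * ((1 - p) ^ k * ((k : ℝ) + 1) ^ s)) →
      ∑' j, g (j + K) ≤ (1 - p)⁻¹ * Θ * ((K : ℝ) + 1) ^ s := by
    intro g h0 h1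
    refine (tsum_shift_le hp0 hp1 s K (by positivity) h0 h1).trans ?_
    rw [← hΘ, mul_right_comm ((1 - p)⁻¹)]
    gcongr
  have hpk : ∀ k ∈ Finset.range K, ((k : ℝ) + 1) ^ s ≤ ((K : ℝ) + 1) ^ s := fun k hk => by
    have : (k : ℝ) ≤ K := by exact_mod_cast (Finset.mem_range.1 hk).le
    gcongr
  constructor
  · obtain ⟨h0, h1⟩ := recMass_sub_recTail_bounds hp0 hp1 m s
    have ht := htail _ h0 h1
    have ht0 : 0 ≤ ∑' j, (recMass p s (j + K) - recTail p m s (j + K)) :=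
      tsum_nonneg fun j => h0 _
    rw [← (summable_of_le_geometric hp0 hp1 s h0 h1).sum_add_tsum_nat_add K,
      Finset.sum_sub_distrib]
    have hf0 : 0 ≤ ∑ k ∈ Finset.range K, recTail p m s k :=
      Finset.sum_nonneg fun k _ => recTail_nonneg hp0 hp1 m s k
    have hf : ∑ k ∈ Finset.range K, recTail p m s k ≤
        4 * ((s + 1) * (s + 2)) / p * ((K : ℝ) + 1) ^ s := by
      have : m * ∑ k ∈ Finset.range K, recTail p m s k ≤
          m * (2 * (s + 1) / p * ((K : ℝ) + 1) ^ s) := by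
        calc m * ∑ k ∈ Finset.range K, recTail p m s k
            ≤ ∑ k ∈ Finset.range K, (s + 1) * ((K : ℝ) + 1) ^ s * ((1 - p)⁻¹) ^ k := by
              rw [Finset.mul_sum]
              refine Finset.sum_le_sum fun k hk => (mul_recTail_le hp0 hp1 m s k).trans ?_
              have := hpk k hk
              gcongr
          _ = (s + 1) * ((K : ℝ) + 1) ^ s * ∑ k ∈ Finset.range K, ((1 - p)⁻¹) ^ k := by
              rw [Finset.mul_sum]
          _ ≤ (s + 1) * ((K : ℝ) + 1) ^ s * ((2 * m) / p) := by
              refine mul_le_mul_of_nonneg_left (hgeo.trans ?_) (by positivity)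
              gcongr
              linarith
          _ = _ := by ring
      refine (le_of_mul_le_mul_left this (by linarith)).trans ?_
      have hs : (0 : ℝ) ≤ s := Nat.cast_nonneg s
      gcongr ?_ / p * _
      nlinarith
    rw [abs_le]
    constructor <;> nlinarith [pow_nonneg (by positivity : (0 : ℝ) ≤ (K : ℝ) + 1) s,
      mul_nonneg (mul_nonneg (inv_nonneg.2 hq.le) hΘ0)
        (pow_nonneg (by positivity : (0 : ℝ) ≤ (K : ℝ) + 1) s)]
  · rw [← (summable_recProb hp0 hp1 m s).sum_add_tsum_nat_add K, mul_add, ← tsum_mul_left,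
      add_mul ((1 - p)⁻¹ * Θ),
      add_comm]
    refine add_le_add (htail (fun k => (m + 1) * recProb p m s k)
      (fun k => mul_nonneg (by positivity) (recProb_nonneg hp0 hp1 m s k))
      fun k => mul_le_mul_of_nonneg_left (recProb_le hp0 hp1 m s k) (by positivity)) ?_
    have hk : ∀ k ∈ Finset.range K, (m : ℝ) ^ 2 * recProb p m s k ≤
        (s + 1) * (s + 2) * ((K : ℝ) + 1) ^ s * ((1 - p)⁻¹) ^ k := by
      intro k hk
      calc (m : ℝ) ^ 2 * recProb p m s k ≤ (1 - p) ^ k * ((m : ℝ) ^ 2 * recTail p m s k) := by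
            rw [mul_left_comm]
            gcongr
            exact recTail_sub_succ_le hp0 hp1 m s k
        _ ≤ (1 - p) ^ k * ((s + 1) * (s + 2) * ((k : ℝ) + 1) ^ s * ((1 - p)⁻¹) ^ (k * 2)) := by
            exact mul_le_mul_of_nonneg_left (sq_mul_recTail_le hp0 hp1 m s k)
              (one_sub_pow_bounds hp0 hp1 k).1.le
        _ = (s + 1) * (s + 2) * ((k : ℝ) + 1) ^ s * ((1 - p)⁻¹) ^ k *
            ((1 - p) * (1 - p)⁻¹) ^ k := by
            rw [mul_two, pow_add, mul_pow]; ring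
        _ ≤ _ := by
            rw [mul_inv_cancel₀ hq.ne', one_pow, mul_one]
            have := hpk k hk
            gcongr
    have : (m : ℝ) ^ 2 * ((m + 1) * ∑ k ∈ Finset.range K, recProb p m s k) ≤
        (m : ℝ) ^ 2 * (4 * ((s + 1) * (s + 2)) / p * ((K : ℝ) + 1) ^ s) := by
      calc (m : ℝ) ^ 2 * ((m + 1) * ∑ k ∈ Finset.range K, recProb p m s k)
          = (m + 1) * ∑ k ∈ Finset.range K, (m : ℝ) ^ 2 * recProb p m s k := by
            rw [← Finset.mul_sum]; ring
        _ ≤ (m + 1) * ∑ k ∈ Finset.range K,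
            (s + 1) * (s + 2) * ((K : ℝ) + 1) ^ s * ((1 - p)⁻¹) ^ k := by
            exact mul_le_mul_of_nonneg_left (Finset.sum_le_sum hk) (by positivity)
        _ = (m + 1) * ((s + 1) * (s + 2) * ((K : ℝ) + 1) ^ s *
            ∑ k ∈ Finset.range K, ((1 - p)⁻¹) ^ k) := by rw [← Finset.mul_sum]
        _ ≤ (2 * m) * ((s + 1) * (s + 2) * ((K : ℝ) + 1) ^ s * ((2 * m) / p)) := by
            have h2 : (m : ℝ) + 1 ≤ 2 * m := by linarith
            have h3 := hgeo.trans (div_le_div_of_nonneg_right h2 hp0.le)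
            gcongr
        _ = _ := by ring
    exact le_of_mul_le_mul_left this (by positivity)

lemma pow_sub_pow_le {a b : ℝ} (hb : 0 ≤ b) (hab : b ≤ a) (s : ℕ) :
    a ^ (s + 1) - b ^ (s + 1) ≤ (s + 1) * (a - b) * a ^ s := by
  induction s with
  | zero => simp
  | succ s ih =>
    have h1 : b ^ (s + 1) ≤ a ^ (s + 1) := by gcongr
    have h2 := mul_le_mul_of_nonneg_left ih (hb.trans hab)
    have h3 := mul_le_mul_of_nonneg_left h1 (sub_nonneg.2 hab)
    push_cast
    rw [pow_succ a (s + 1), pow_succ b (s + 1)]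
    rw [pow_succ a s] at *
    linarith

lemma exists_bound_sum_recMass (hp0 : 0 < p) (hp1 : p < 1) (s : ℕ) :
    ∃ C : ℝ, 0 ≤ C ∧ ∀ (K : ℕ) (L : ℝ), (K : ℝ) ≤ L → L ≤ K + 1 →
      |∑ k ∈ Finset.range K, recMass p s k - 1 / ((s + 1).factorial : ℝ) * (p * L) ^ (s + 1)| ≤
        C * ((K : ℝ) + 1) ^ s := by
  refine ⟨(s + 1) * (s + 1) * (s + 1) ^ s, by positivity, ?_⟩
  intro K L h1 h2
  have hK : (0 : ℝ) ≤ K := Nat.cast_nonneg K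
  have hs : (0 : ℝ) ≤ s := Nat.cast_nonneg s
  have hlo : (K : ℝ) ^ (s + 1) ≤ (K.ascFactorial (s + 1) : ℕ) := by
    exact_mod_cast Nat.pow_succ_le_ascFactorial K (s + 1)
  have hhi : ((K.ascFactorial (s + 1) : ℕ) : ℝ) ≤ ((K : ℝ) + (s + 1)) ^ (s + 1) := by
    have h : K.ascFactorial (s + 1) ≤ (K + (s + 1)) ^ (s + 1) :=
      (Nat.ascFactorial_le _ (Nat.le_succ K)).trans
      (Nat.ascFactorial_le_pow_add K (s + 1))
    exact_mod_cast h
  have hLlo : (K : ℝ) ^ (s + 1) ≤ L ^ (s + 1) := by gcongr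
  have hLhi : L ^ (s + 1) ≤ ((K : ℝ) + (s + 1)) ^ (s + 1) := by
    have : 0 ≤ L := hK.trans h1
    gcongr
    linarith
  have hd := pow_sub_pow_le hK (by linarith : (K : ℝ) ≤ (K : ℝ) + (s + 1)) s
  have he : ((K : ℝ) + (s + 1)) ^ s ≤ (s + 1) ^ s * ((K : ℝ) + 1) ^ s := by
    rw [← mul_pow]
    gcongr
    nlinarith
  rw [sum_recMass, mul_pow]
  have hc : p ^ (s + 1) / ((s + 1).factorial : ℝ) ≤ 1 :=
    div_le_one_of_le₀ ((pow_le_one₀ hp0.le hp1.le).trans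
      (by exact_mod_cast Nat.one_le_iff_ne_zero.2 (Nat.factorial_ne_zero _))) (by positivity)
  rw [show p ^ (s + 1) * ((K.ascFactorial (s + 1) : ℕ) : ℝ) / ((s + 1).factorial : ℝ) -
      1 / ((s + 1).factorial : ℝ) * (p ^ (s + 1) * L ^ (s + 1)) =
      p ^ (s + 1) / ((s + 1).factorial : ℝ) *
        (((K.ascFactorial (s + 1) : ℕ) : ℝ) - L ^ (s + 1)) by ring, abs_mul,
    abs_of_nonneg (by positivity)]
  have habs : |((K.ascFactorial (s + 1) : ℕ) : ℝ) - L ^ (s + 1)| ≤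
      (s + 1) * (s + 1) * (s + 1) ^ s * ((K : ℝ) + 1) ^ s := by
    have : (s + 1) * (s + 1) * ((K : ℝ) + (s + 1)) ^ s ≤
        (s + 1) * (s + 1) * ((s + 1) ^ s * ((K : ℝ) + 1) ^ s) := by gcongr
    have e : (K : ℝ) + (s + 1) - K = s + 1 := by ring
    rw [e] at hd
    rw [abs_le]
    constructor <;> linarith
  refine (mul_le_mul hc habs (abs_nonneg _) zero_le_one).trans ?_
  rw [one_mul]

end Analysis

section Words

open Finset

/-- The largest letter of a word, with value `0` for the empty word. -/
def wordMax {n : ℕ} (w : Fin n → ℕ) : ℕ := univ.sup w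

/-- The positions of the weak left-to-right maxima of a word, in increasing order. -/
def weakLTRMaxList {n : ℕ} (w : Fin n → ℕ) : List ℕ :=
  ((weakLTRMaxSet w).sort (· ≤ ·)).map (fun j : Fin n => (j : ℕ) + 1)

lemma length_weakLTRMaxList {n : ℕ} (w : Fin n → ℕ) :
    (weakLTRMaxList w).length = (weakLTRMaxSet w).card := by
  simp [weakLTRMaxList]

lemma weakLTRMaxPos_eq_getD {n : ℕ} (w : Fin n → ℕ) (R : ℕ) :
    weakLTRMaxPos w (R + 1) = (weakLTRMaxList w).getD R 0 := by
  unfold weakLTRMaxPos weakLTRMaxList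
  congr 1
  rw [bind_pure_comp, List.map_eq_map, List.map_map]
  rfl

lemma wordMax_snoc {n : ℕ} (w : Fin n → ℕ) (a : ℕ) :
    wordMax (Fin.snoc w a : Fin (n + 1) → ℕ) = max (wordMax w) a := by
  apply le_antisymm
  · refine Finset.sup_le fun j _ => ?_
    induction j using Fin.lastCases with
    | last => simp
    | cast i => simpa [wordMax] using Or.inl (Finset.le_sup (f := w) (mem_univ i))
  · refine max_le (Finset.sup_le fun j _ => ?_) ?_
    · simpa [wordMax] using
        Finset.le_sup (f := (Fin.snoc w a : Fin (n + 1) → ℕ)) (mem_univ j.castSucc)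
    · simpa [wordMax] using
        Finset.le_sup (f := (Fin.snoc w a : Fin (n + 1) → ℕ)) (mem_univ (Fin.last n))

lemma castSucc_mem_weakLTRMaxSet_snoc {n : ℕ} (w : Fin n → ℕ) (a : ℕ) (j : Fin n) :
    j.castSucc ∈ weakLTRMaxSet (Fin.snoc w a : Fin (n + 1) → ℕ) ↔ j ∈ weakLTRMaxSet w := by
  simp only [weakLTRMaxSet, mem_filter, mem_univ, true_and]
  constructor
  · intro h i hi
    simpa using h i.castSucc (by simpa using hi)
  · intro h i
    induction i using Fin.lastCases with
    | last => intro hi; exact absurd hi (not_lt.2 (Fin.le_last _))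
    | cast i => intro hi; simpa using h i (by simpa using hi)

lemma last_mem_weakLTRMaxSet_snoc {n : ℕ} (w : Fin n → ℕ) (a : ℕ) :
    Fin.last n ∈ weakLTRMaxSet (Fin.snoc w a : Fin (n + 1) → ℕ) ↔ wordMax w ≤ a := by
  simp only [weakLTRMaxSet, mem_filter, mem_univ, true_and, wordMax, Finset.sup_le_iff]
  constructor
  · intro h i _
    simpa using h i.castSucc (Fin.castSucc_lt_last i)
  · intro h i
    induction i using Fin.lastCases with
    | last => intro hi; exact absurd hi (lt_irrefl _)
    | cast i => intro _; simpa using h i trivial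

lemma weakLTRMaxList_snoc {n : ℕ} (w : Fin n → ℕ) (a : ℕ) :
    weakLTRMaxList (Fin.snoc w a : Fin (n + 1) → ℕ) =
      weakLTRMaxList w ++ if wordMax w ≤ a then [n + 1] else [] := by
  have h : (weakLTRMaxSet (Fin.snoc w a : Fin (n + 1) → ℕ)).sort (· ≤ ·) =
      ((weakLTRMaxSet w).sort (· ≤ ·)).map Fin.castSucc ++
        if wordMax w ≤ a then [Fin.last n] else [] := by
    have hnd : (((weakLTRMaxSet w).sort (· ≤ ·)).map Fin.castSucc ++
        if wordMax w ≤ a then [Fin.last n] else []).Nodup := by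
      rw [List.nodup_append]
      refine ⟨(Finset.sort_nodup _ _).map (Fin.castSucc_injective n), by split_ifs <;> simp, ?_⟩
      intro x hx y hy
      obtain ⟨z, -, rfl⟩ := List.mem_map.1 hx
      split_ifs at hy <;> simp at hy
      rw [hy]
      exact (Fin.castSucc_lt_last z).ne
    have hset : weakLTRMaxSet (Fin.snoc w a : Fin (n + 1) → ℕ) =
        (((weakLTRMaxSet w).sort (· ≤ ·)).map Fin.castSucc ++
          if wordMax w ≤ a then [Fin.last n] else []).toFinset := by
      ext j
      induction j using Fin.lastCases with
      | last =>
        rw [last_mem_weakLTRMaxSet_snoc]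
        split_ifs with h <;> simp [h, (Fin.castSucc_lt_last _).ne]
      | cast j =>
        rw [castSucc_mem_weakLTRMaxSet_snoc]
        split_ifs with h <;> simp [(Fin.castSucc_lt_last _).ne]
    rw [hset, List.toFinset_sort _ hnd, List.pairwise_append]
    refine ⟨?_, by split_ifs <;> simp, ?_⟩
    · rw [List.pairwise_map]
      exact (Finset.pairwise_sort _ _).imp fun h => by simpa using h
    · intro x hx y hy
      split_ifs at hy <;> simp at hy
      rw [hy]
      exact Fin.le_last _
  unfold weakLTRMaxList
  rw [h, List.map_append, List.map_map]
  congr 1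
  split_ifs <;> simp

lemma card_weakLTRMaxSet_snoc {n : ℕ} (w : Fin n → ℕ) (a : ℕ) :
    (weakLTRMaxSet (Fin.snoc w a : Fin (n + 1) → ℕ)).card =
      (weakLTRMaxSet w).card + if wordMax w ≤ a then 1 else 0 := by
  rw [← length_weakLTRMaxList, ← length_weakLTRMaxList, weakLTRMaxList_snoc, List.length_append]
  congr 1
  split_ifs <;> simp

/-- Appending a letter changes the position of the `(R + 1)`-st weak left-to-right maximum, cut off
to `0` if there is none, only if the new letter is that maximum. -/
lemma cutoff_weakLTRMaxPos_snoc {n : ℕ} (w : Fin n → ℕ) (a R : ℕ) :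
    (if R + 1 ≤ (weakLTRMaxSet (Fin.snoc w a : Fin (n + 1) → ℕ)).card then
      (weakLTRMaxPos (Fin.snoc w a : Fin (n + 1) → ℕ) (R + 1) : ℝ) else 0) =
    (if R + 1 ≤ (weakLTRMaxSet w).card then (weakLTRMaxPos w (R + 1) : ℝ) else 0) +
      if (weakLTRMaxSet w).card = R ∧ wordMax w ≤ a then (n : ℝ) + 1 else 0 := by
  rw [weakLTRMaxPos_eq_getD, weakLTRMaxPos_eq_getD, weakLTRMaxList_snoc,
    card_weakLTRMaxSet_snoc, ← length_weakLTRMaxList]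
  by_cases hm : wordMax w ≤ a
  · simp only [hm, if_true, and_true]
    rcases lt_trichotomy (weakLTRMaxList w).length R with h | h | h
    · rw [if_neg (by omega), if_neg (by omega), if_neg (by omega), add_zero]
    · rw [if_pos (by omega), if_neg (by omega), if_pos h, List.getD_append_right _ _ _ _ h.le, h]
      simp
    · rw [if_pos (by omega), if_pos (by omega), if_neg (by omega), List.getD_append _ _ _ _ h,
        add_zero]
  · simp [hm]

lemma cutoff_weakLTRMaxPos_le {n : ℕ} (w : Fin n → ℕ) (R : ℕ) :
    |(if R + 1 ≤ (weakLTRMaxSet w).card then (weakLTRMaxPos w (R + 1) : ℝ) else 0)| ≤ n := by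
  split_ifs with h
  · have hR : R < (weakLTRMaxList w).length := by rw [length_weakLTRMaxList]; omega
    have hmem := List.getElem_mem hR
    rw [weakLTRMaxPos_eq_getD, List.getD_eq_getElem _ _ hR, Nat.abs_cast, Nat.cast_le]
    obtain ⟨j, -, hj⟩ := List.mem_map.1 hmem
    rw [← hj]
    exact j.2
  · simp

lemma card_weakLTRMaxSet_pos {n : ℕ} (w : Fin (n + 1) → ℕ) : 0 < (weakLTRMaxSet w).card :=
  card_pos.2 ⟨0, by simp [weakLTRMaxSet]⟩

variable {p : ℝ}

lemma geomWt_nonneg (hp0 : 0 < p) (hp1 : p < 1) (k : ℕ) : 0 ≤ geomWt p k := by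
  have hq : 0 < 1 - p := by linarith
  unfold geomWt
  split_ifs <;> positivity

lemma hasSum_geomWt_ge (hp0 : 0 < p) (hp1 : p < 1) (v : ℕ) :
    HasSum (fun a => if v ≤ a then geomWt p a else 0) ((1 - p) ^ (v - 1)) := by
  have hq : 0 < 1 - p := by linarith
  have h := (hasSum_geometric_of_lt_one hq.le (by linarith : 1 - p < 1)).mul_left
    (p * (1 - p) ^ (v - 1))
  rw [sub_sub_cancel, mul_right_comm, mul_inv_cancel₀ hp0.ne', one_mul] at h
  rw [← hasSum_nat_add_iff' (v - 1 + 1), Finset.sum_eq_zero, sub_zero]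
  · refine h.congr_fun fun a => ?_
    rw [if_pos (by omega), geomWt, if_pos (by omega),
      show a + (v - 1 + 1) - 1 = (v - 1) + a by omega, pow_add, mul_assoc]
  · intro a ha
    rw [Finset.mem_range] at ha
    unfold geomWt
    split_ifs <;> first | rfl | omega

lemma hasSum_geomWt (hp0 : 0 < p) (hp1 : p < 1) : HasSum (geomWt p) 1 := by
  simpa using hasSum_geomWt_ge hp0 hp1 0

lemma hasSum_geomWt_lt (hp0 : 0 < p) (hp1 : p < 1) (v : ℕ) :
    HasSum (fun a => if a < v then geomWt p a else 0) (1 - (1 - p) ^ (v - 1)) := by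
  refine ((hasSum_geomWt hp0 hp1).sub (hasSum_geomWt_ge hp0 hp1 v)).congr_fun fun a => ?_
  by_cases h : a < v
  · simp [h, not_le.2 h]
  · simp [h, not_lt.1 h]

lemma wordWt_nonneg (hp0 : 0 < p) (hp1 : p < 1) {n : ℕ} (w : Fin n → ℕ) : 0 ≤ wordWt p w :=
  Finset.prod_nonneg fun _ _ => geomWt_nonneg hp0 hp1 _

lemma wordWt_snoc {n : ℕ} (w : Fin n → ℕ) (a : ℕ) :
    wordWt p (Fin.snoc w a : Fin (n + 1) → ℕ) = wordWt p w * geomWt p a := by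
  simp [wordWt, Fin.prod_univ_castSucc]

/-- Appending a letter, as an equivalence. -/
def appendEquiv (n : ℕ) : (Fin n → ℕ) × ℕ ≃ (Fin (n + 1) → ℕ) :=
  (Equiv.prodComm _ _).trans (Fin.snocEquiv fun _ => ℕ)

lemma appendEquiv_apply {n : ℕ} (x : (Fin n → ℕ) × ℕ) :
    appendEquiv n x = (Fin.snoc x.1 x.2 : Fin (n + 1) → ℕ) := rfl

lemma hasSum_wordWt (hp0 : 0 < p) (hp1 : p < 1) (n : ℕ) :
    HasSum (fun w : Fin n → ℕ => wordWt p w) 1 := by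
  induction n with
  | zero => simp [wordWt, hasSum_unique]
  | succ n ih =>
    rw [← (appendEquiv n).hasSum_iff]
    have hs := Summable.mul_of_nonneg ih.summable (hasSum_geomWt hp0 hp1).summable
      (fun w => wordWt_nonneg hp0 hp1 w) (fun a => geomWt_nonneg hp0 hp1 a)
    have := ih.mul (hasSum_geomWt hp0 hp1) hs
    rw [one_mul] at this
    exact this.congr_fun fun x => wordWt_snoc x.1 x.2

/-- The expectation of a function of a random geometric word. -/
noncomputable def wordExp (p : ℝ) {n : ℕ} (f : (Fin n → ℕ) → ℝ) : ℝ := ∑' w, f w * wordWt p w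

lemma summable_mul_wordWt (hp0 : 0 < p) (hp1 : p < 1) {n : ℕ} {f : (Fin n → ℕ) → ℝ} {B : ℝ}
    (hf : ∀ w, |f w| ≤ B) : Summable fun w => f w * wordWt p w := by
  refine Summable.of_norm_bounded ((hasSum_wordWt hp0 hp1 n).summable.mul_left B) fun w => ?_
  rw [norm_mul, Real.norm_eq_abs, Real.norm_of_nonneg (wordWt_nonneg hp0 hp1 w)]
  exact mul_le_mul_of_nonneg_right (hf w) (wordWt_nonneg hp0 hp1 w)

lemma wordExp_succ (hp0 : 0 < p) (hp1 : p < 1) {n : ℕ} {f : (Fin (n + 1) → ℕ) → ℝ} {B : ℝ}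
    (hf : ∀ w, |f w| ≤ B) {g : (Fin n → ℕ) → ℝ}
    (hg : ∀ w, HasSum (fun a => f (Fin.snoc w a) * geomWt p a) (g w)) :
    wordExp p f = wordExp p g := by
  have hs := summable_mul_wordWt hp0 hp1 hf
  rw [← (appendEquiv n).summable_iff] at hs
  unfold wordExp
  rw [← (appendEquiv n).tsum_eq]
  refine (Summable.tsum_prod hs).trans (tsum_congr fun w => ?_)
  rw [← (hg w).tsum_eq, ← tsum_mul_right]
  refine tsum_congr fun a => ?_
  rw [Function.comp_apply, appendEquiv_apply, wordWt_snoc]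
  ring

lemma wordExp_add (hp0 : 0 < p) (hp1 : p < 1) {n : ℕ} {f g : (Fin n → ℕ) → ℝ} {A B : ℝ}
    (hf : ∀ w, |f w| ≤ A) (hg : ∀ w, |g w| ≤ B) :
    wordExp p (fun w => f w + g w) = wordExp p f + wordExp p g := by
  unfold wordExp
  rw [← Summable.tsum_add (summable_mul_wordWt hp0 hp1 hf) (summable_mul_wordWt hp0 hp1 hg)]
  exact tsum_congr fun w => add_mul _ _ _

lemma wordExp_mul_left {n : ℕ} (c : ℝ) (f : (Fin n → ℕ) → ℝ) :
    wordExp p (fun w => c * f w) = c * wordExp p f := by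
  unfold wordExp
  rw [← tsum_mul_left]
  exact tsum_congr fun w => mul_assoc _ _ _

lemma wordExp_sum (hp0 : 0 < p) (hp1 : p < 1) {n : ℕ} {ι : Type*} (s : Finset ι)
    {f : ι → (Fin n → ℕ) → ℝ} {B : ℝ} (hf : ∀ i w, |f i w| ≤ B) :
    wordExp p (fun w => ∑ i ∈ s, f i w) = ∑ i ∈ s, wordExp p (f i) := by
  unfold wordExp
  rw [← Summable.tsum_finsetSum fun i _ => summable_mul_wordWt hp0 hp1 (hf i)]
  exact tsum_congr fun w => Finset.sum_mul _ _ _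

lemma abs_ite_one_le (P : Prop) [Decidable P] : |(if P then (1 : ℝ) else 0)| ≤ 1 := by
  split_ifs <;> simp

/-- The probability that the word has `s` weak left-to-right maxima and largest letter `v`. -/
noncomputable def jointProb (p : ℝ) (n s v : ℕ) : ℝ :=
  wordExp p fun w : Fin n → ℕ => if (weakLTRMaxSet w).card = s ∧ wordMax w = v then 1 else 0

lemma jointProb_zero (s v : ℕ) : jointProb p 0 s v = if s = 0 ∧ v = 0 then 1 else 0 := by
  unfold jointProb wordExp
  rw [tsum_eq_single default fun w hw => absurd (Subsingleton.elim _ _) hw]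
  simp [wordWt, wordMax, weakLTRMaxSet, eq_comm]

lemma jointProb_succ_zero (n v : ℕ) : jointProb p (n + 1) 0 v = 0 := by
  unfold jointProb wordExp
  simp [(card_weakLTRMaxSet_pos _).ne']

lemma jointProb_succ_succ (hp0 : 0 < p) (hp1 : p < 1) (n s v : ℕ) :
    jointProb p (n + 1) (s + 1) v = (1 - (1 - p) ^ (v - 1)) * jointProb p n (s + 1) v +
      geomWt p v * ∑ u ∈ Finset.range (v + 1), jointProb p n s u := by
  have hb : ∀ P : Prop, [Decidable P] → ∀ c : ℝ, |c * (if P then (1 : ℝ) else 0)| ≤ |c| := by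
    intro P _ c
    rw [abs_mul]
    exact mul_le_of_le_one_right (abs_nonneg c) (abs_ite_one_le P)
  have hsum : ∑ u ∈ Finset.range (v + 1), jointProb p n s u =
      wordExp p fun w : Fin n → ℕ =>
        if (weakLTRMaxSet w).card = s ∧ wordMax w ≤ v then 1 else 0 := by
    unfold jointProb
    rw [← wordExp_sum hp0 hp1 _ (fun u w => abs_ite_one_le _)]
    congr 1
    ext w
    by_cases hs : (weakLTRMaxSet w).card = s <;> simp [hs]
  rw [hsum]
  unfold jointProb
  rw [← wordExp_mul_left, ← wordExp_mul_left, ← wordExp_add hp0 hp1 (fun w => hb _ _)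
    (fun w => hb _ _)]
  refine wordExp_succ hp0 hp1 (fun w => abs_ite_one_le _) fun w => ?_
  have h1 := (hasSum_geomWt_lt hp0 hp1 v).mul_right
    (if (weakLTRMaxSet w).card = s + 1 ∧ wordMax w = v then (1 : ℝ) else 0)
  have h2 := (hasSum_ite_eq v (geomWt p v)).mul_right
    (if (weakLTRMaxSet w).card = s ∧ wordMax w ≤ v then (1 : ℝ) else 0)
  refine (h1.add h2).congr_fun fun a => ?_
  rw [card_weakLTRMaxSet_snoc, wordMax_snoc]
  rcases lt_trichotomy a v with h | rfl | h
  · have e : max (wordMax w) a = v ↔ wordMax w = v := by omega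
    by_cases hv : wordMax w = v
    · simp [h, h.ne, hv, not_le.2 h, h.le]
    · simp [h, h.ne, hv, e]
  · by_cases hv : wordMax w ≤ a
    · simp [hv]
    · have hv' : wordMax w ≠ a := by omega
      simp [hv, hv']
  · have e : max (wordMax w) a ≠ v := by omega
    simp [e, h.ne', h.not_gt]

lemma jointProb_succ_at_zero (hp0 : 0 < p) (hp1 : p < 1) (n s : ℕ) :
    jointProb p n (s + 1) 0 = 0 := by
  cases n with
  | zero => simp [jointProb_zero]
  | succ n => simp [jointProb_succ_succ hp0 hp1, geomWt]

lemma jointProb_eq_recProb (hp0 : 0 < p) (hp1 : p < 1) (m s k : ℕ) :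
    jointProb p (m + 1) (s + 1) (k + 1) = recProb p m s k := by
  have hg : geomWt p (k + 1) = p * (1 - p) ^ k := by simp [geomWt]
  induction m generalizing s k with
  | zero =>
    rw [jointProb_succ_succ hp0 hp1, jointProb_zero, hg]
    cases s with
    | zero => simp [jointProb_zero, recProb_zero_zero]
    | succ s => simp [jointProb_zero, recProb_zero_succ]
  | succ m ih =>
    rw [jointProb_succ_succ hp0 hp1, ih s k hg, hg, add_tsub_cancel_right]
    cases s with
    | zero => simp [jointProb_succ_zero, recProb_succ_zero]
    | succ s =>
      rw [recProb_succ_succ, Finset.sum_range_succ', jointProb_succ_at_zero hp0 hp1, add_zero]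
      congr 2
      exact Finset.sum_congr rfl fun u _ => ih s u (by simp [geomWt])

lemma hasSum_jointProb (hp0 : 0 < p) (hp1 : p < 1) (n s : ℕ) :
    HasSum (jointProb p n s)
      (wordExp p fun w : Fin n → ℕ => if (weakLTRMaxSet w).card = s then 1 else 0) := by
  have h := (summable_mul_wordWt hp0 hp1 (n := n)
    (f := fun w => if (weakLTRMaxSet w).card = s then (1 : ℝ) else 0)
    (fun w => abs_ite_one_le _)).hasSum.tsum_fiberwise wordMax
  refine h.congr_fun fun v => ?_
  rw [tsum_subtype (wordMax ⁻¹' {v})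
    fun w : Fin n → ℕ => (if (weakLTRMaxSet w).card = s then (1 : ℝ) else 0) * wordWt p w]
  unfold jointProb wordExp
  refine tsum_congr fun w => ?_
  by_cases hv : wordMax w = v <;> simp [hv, Set.indicator]

lemma wordExp_card_eq (hp0 : 0 < p) (hp1 : p < 1) (m s : ℕ) :
    wordExp p (fun w : Fin (m + 1) → ℕ => if (weakLTRMaxSet w).card = s + 1 then 1 else 0) =
      ∑' k, recProb p m s k := by
  have h := hasSum_jointProb hp0 hp1 (m + 1) (s + 1)
  rw [← h.tsum_eq, h.summable.tsum_eq_zero_add, jointProb_succ_at_zero hp0 hp1, zero_add]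
  exact tsum_congr fun k => jointProb_eq_recProb hp0 hp1 m s k

/-- The probability that the word has at least `R + 1` weak left-to-right maxima. -/
noncomputable def existProb (p : ℝ) (n R : ℕ) : ℝ :=
  wordExp p fun w : Fin n → ℕ => if R + 1 ≤ (weakLTRMaxSet w).card then 1 else 0

/-- The unnormalized average position of the `(R + 1)`-st weak left-to-right maximum. -/
noncomputable def posExp (p : ℝ) (n R : ℕ) : ℝ :=
  wordExp p fun w : Fin n → ℕ =>
    if R + 1 ≤ (weakLTRMaxSet w).card then (weakLTRMaxPos w (R + 1) : ℝ) else 0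

lemma existProb_succ_eq (hp0 : 0 < p) (hp1 : p < 1) (m R : ℕ) :
    existProb p (m + 1) R = 1 - ∑ s ∈ Finset.range R, ∑' k, recProb p m s k := by
  rw [eq_sub_iff_add_eq]
  simp_rw [← wordExp_card_eq hp0 hp1]
  have hbd : ∀ w : Fin (m + 1) → ℕ, ∑ s ∈ Finset.range R,
      (if (weakLTRMaxSet w).card = s + 1 then (1 : ℝ) else 0) =
        if R + 1 ≤ (weakLTRMaxSet w).card then 0 else 1 := by
    intro w
    obtain ⟨c, hc⟩ := Nat.exists_eq_succ_of_ne_zero (card_weakLTRMaxSet_pos w).ne'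
    rw [hc]
    by_cases h : c < R
    · simp [h]
    · simp [h, not_lt.1 h]
  have h1 : wordExp p (fun _ : Fin (m + 1) → ℕ => 1) = 1 := by
    simpa [wordExp] using (hasSum_wordWt hp0 hp1 (m + 1)).tsum_eq
  rw [← wordExp_sum hp0 hp1 _ (fun s w => abs_ite_one_le _), existProb,
    ← wordExp_add hp0 hp1 (fun w => abs_ite_one_le _)
      (fun w => (Finset.abs_sum_le_sum_abs _ _).trans
        (Finset.sum_le_sum fun s _ => abs_ite_one_le _))]
  refine Eq.trans ?_ h1
  congr 1
  ext w
  rw [hbd]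
  split_ifs <;> simp

lemma wordExp_increment (hp0 : 0 < p) (hp1 : p < 1) {n : ℕ} (R : ℕ) (c : ℝ)
    {f : (Fin (n + 1) → ℕ) → ℝ} {g : (Fin n → ℕ) → ℝ} {A B : ℝ} (hf : ∀ w, |f w| ≤ A)
    (hg : ∀ w, |g w| ≤ B)
    (h : ∀ w a, f (Fin.snoc w a) =
      g w + if (weakLTRMaxSet w).card = R ∧ wordMax w ≤ a then c else 0) :
    wordExp p f = wordExp p g + c * wordExp p fun w : Fin n → ℕ =>
      if (weakLTRMaxSet w).card = R then (1 - p) ^ (wordMax w - 1) else 0 := by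
  have hq : 0 ≤ 1 - p := by linarith
  have hb : ∀ w : Fin n → ℕ,
      |c * (if (weakLTRMaxSet w).card = R then (1 - p) ^ (wordMax w - 1) else 0)| ≤ |c| := by
    intro w
    rw [abs_mul]
    refine mul_le_of_le_one_right (abs_nonneg c) ?_
    split_ifs
    · rw [abs_of_nonneg (pow_nonneg hq _)]
      exact pow_le_one₀ hq (by linarith)
    · simp
  rw [← wordExp_mul_left, ← wordExp_add hp0 hp1 hg hb]
  refine wordExp_succ hp0 hp1 hf fun w => ?_
  have h1 := (hasSum_geomWt hp0 hp1).mul_left (g w)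
  have h2 := (hasSum_geomWt_ge hp0 hp1 (wordMax w)).mul_left
    (c * if (weakLTRMaxSet w).card = R then 1 else 0)
  rw [mul_one] at h1
  have h3 := h1.add h2
  rw [show c * (if (weakLTRMaxSet w).card = R then (1 - p) ^ (wordMax w - 1) else 0) =
    (c * if (weakLTRMaxSet w).card = R then 1 else 0) * (1 - p) ^ (wordMax w - 1) by
      split_ifs <;> simp]
  refine h3.congr_fun fun a => ?_
  rw [h]
  by_cases hc : (weakLTRMaxSet w).card = R <;> by_cases hm : wordMax w ≤ a <;>
    simp [hc, hm, add_mul]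

lemma posExp_eq (hp0 : 0 < p) (hp1 : p < 1) (n R : ℕ) :
    posExp p n R = n * existProb p n R - ∑ m ∈ Finset.range n, existProb p m R := by
  induction n with
  | zero => simp [posExp, wordExp, weakLTRMaxSet]
  | succ n ih =>
    have h1 := wordExp_increment hp0 hp1 R ((n : ℝ) + 1)
      (fun w : Fin (n + 1) → ℕ => cutoff_weakLTRMaxPos_le w R)
      (fun w : Fin n → ℕ => cutoff_weakLTRMaxPos_le w R)
      (fun w a => cutoff_weakLTRMaxPos_snoc w a R)
    have h2 := wordExp_increment hp0 hp1 R 1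
      (f := fun w : Fin (n + 1) → ℕ => if R + 1 ≤ (weakLTRMaxSet w).card then (1 : ℝ) else 0)
      (g := fun w : Fin n → ℕ => if R + 1 ≤ (weakLTRMaxSet w).card then (1 : ℝ) else 0)
      (fun w => abs_ite_one_le _) (fun w => abs_ite_one_le _) (fun w a => by
        rw [card_weakLTRMaxSet_snoc]
        by_cases hm : wordMax w ≤ a
        · rcases lt_trichotomy (weakLTRMaxSet w).card R with h | h | h
          · simp [hm, h.ne, not_le.2 h, not_le.2 (h.trans (Nat.lt_succ_self R))]
          · simp [hm, h]
          · simp [hm, h.ne', Nat.succ_le_of_lt h, h.le]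
        · simp [hm])
    change posExp p (n + 1) R = posExp p n R + _ at h1
    change existProb p (n + 1) R = existProb p n R + _ at h2
    rw [Finset.sum_range_succ]
    push_cast
    linear_combination h1 + ih - ((n : ℝ) + 1) * h2

lemma existProb_zero (R : ℕ) : existProb p 0 R = 0 := by
  simp [existProb, wordExp, weakLTRMaxSet]

lemma posExp_succ_eq (hp0 : 0 < p) (hp1 : p < 1) (m R : ℕ) :
    posExp p (m + 1) R = 1 + ∑ s ∈ Finset.range R, ∑' k, (recMass p s k - recTail p m s k) -
      ∑ s ∈ Finset.range R, ((m : ℝ) + 1) * ∑' k, recProb p m s k := by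
  rw [posExp_eq hp0 hp1, Finset.sum_range_succ', existProb_zero, existProb_succ_eq hp0 hp1,
    ← Finset.mul_sum]
  simp_rw [existProb_succ_eq hp0 hp1, ← sum_tsum_recProb hp0 hp1]
  rw [Finset.sum_sub_distrib, Finset.sum_comm]
  simp
  ring

end Words

section Asymptotics

open Filter

variable {p : ℝ}

lemma abs_div_sub_le {N D X Y C n : ℝ} (hn : 0 < n) (hX0 : 0 ≤ X) (hX : X ≤ n)
    (hD : n * (1 - D) ≤ C * Y) (hD1 : D ≤ 1) (hCY : C * Y ≤ n / 2) (hN : |N - X| ≤ C * Y) :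
    |N / D - X| ≤ 4 * (C * Y) := by
  have hDhalf : 1 / 2 ≤ D := by
    have : n * (1 - D) ≤ n * (1 / 2) := by linarith
    have := le_of_mul_le_mul_left this hn
    linarith
  have hD0 : 0 < D := by linarith
  have hCY0 : 0 ≤ C * Y := (abs_nonneg _).trans hN
  have h1 : N / D - X = ((N - X) + (1 - D) * X) / D := by field_simp; ring
  rw [h1, abs_div, abs_of_pos hD0, div_le_iff₀ hD0]
  have h2 : |(1 - D) * X| ≤ C * Y := by
    rw [abs_of_nonneg (mul_nonneg (by linarith) hX0)]
    nlinarith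
  have := abs_add_le (N - X) ((1 - D) * X)
  nlinarith

/-- Bounds for the unnormalized average position and for the probability of having too few
weak left-to-right maxima, in terms of the integer part `K` of `log_Q (m + 1)`. -/
lemma exists_bound_posExp (hp0 : 0 < p) (hp1 : p < 1) (t : ℕ) :
    ∃ C : ℝ, 0 ≤ C ∧ ∀ (m K : ℕ) (L : ℝ), 1 ≤ m → ((1 - p)⁻¹) ^ K ≤ (m : ℝ) + 1 →
      (m : ℝ) + 1 ≤ ((1 - p)⁻¹) ^ (K + 1) → (K : ℝ) ≤ L → L ≤ K + 1 →
      |posExp p (m + 1) (t + 1) - 1 / ((t + 1).factorial : ℝ) * (p * L) ^ (t + 1)| ≤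
        C * ((K : ℝ) + 1) ^ t ∧
      ((m : ℝ) + 1) * (1 - existProb p (m + 1) (t + 1)) ≤ C * ((K : ℝ) + 1) ^ t := by
  choose A hA0 hA using exists_bound_tsum hp0 hp1
  obtain ⟨B, hB0, hB⟩ := exists_bound_sum_recMass hp0 hp1 t
  refine ⟨1 + 2 * ∑ s ∈ Finset.range (t + 1), A s + t + B, ?_, ?_⟩
  · have := Finset.sum_nonneg fun s (_ : s ∈ Finset.range (t + 1)) => hA0 s
    positivity
  intro m K L hm h1 h2 h3 h4
  have hA' := fun s => hA s m K hm h1 h2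
  have hB' := hB K L h3 h4
  have hK1 : (1 : ℝ) ≤ (K : ℝ) + 1 := by linarith [(Nat.cast_nonneg K : (0 : ℝ) ≤ K)]
  set Y := ((K : ℝ) + 1) ^ t with hY
  have hY1 : 1 ≤ Y := one_le_pow₀ hK1
  have hpow : ∀ s ∈ Finset.range (t + 1), A s * ((K : ℝ) + 1) ^ s ≤ A s * Y := fun s hs =>
    mul_le_mul_of_nonneg_left
      (pow_le_pow_right₀ hK1 (Finset.mem_range_succ_iff.1 hs)) (hA0 s)
  have hV : ∑ s ∈ Finset.range (t + 1), ((m : ℝ) + 1) * ∑' k, recProb p m s k ≤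
      (∑ s ∈ Finset.range (t + 1), A s) * Y := by
    rw [Finset.sum_mul]
    exact Finset.sum_le_sum fun s hs => (hA' s).2.trans (hpow s hs)
  have hV0 : 0 ≤ ∑ s ∈ Finset.range (t + 1), ((m : ℝ) + 1) * ∑' k, recProb p m s k :=
    Finset.sum_nonneg fun s _ => mul_nonneg (by positivity)
      (tsum_nonneg fun k => recProb_nonneg hp0 hp1 m s k)
  have hS0 : 0 ≤ (∑ s ∈ Finset.range (t + 1), A s) * Y := hV0.trans hV
  constructor
  · have hU : |∑ s ∈ Finset.range (t + 1), ∑' k, (recMass p s k - recTail p m s k) -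
        ∑ s ∈ Finset.range (t + 1), ∑ k ∈ Finset.range K, recMass p s k| ≤
        (∑ s ∈ Finset.range (t + 1), A s) * Y := by
      rw [← Finset.sum_sub_distrib, Finset.sum_mul]
      exact (Finset.abs_sum_le_sum_abs _ _).trans
        (Finset.sum_le_sum fun s hs => (hA' s).1.trans (hpow s hs))
    have hG0 : 0 ≤ ∑ s ∈ Finset.range t, ∑ k ∈ Finset.range K, recMass p s k :=
      Finset.sum_nonneg fun s _ => Finset.sum_nonneg fun k _ => recMass_nonneg hp0 s k
    have hG : ∑ s ∈ Finset.range t, ∑ k ∈ Finset.range K, recMass p s k ≤ t * Y := by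
      have : ∀ s ∈ Finset.range t, ∑ k ∈ Finset.range K, recMass p s k ≤ Y := by
        intro s hs
        calc ∑ k ∈ Finset.range K, recMass p s k
            ≤ ∑ k ∈ Finset.range K, ((K : ℝ) + 1) ^ s := by
              refine Finset.sum_le_sum fun k hk => (recMass_le hp0 hp1 s k).trans ?_
              have : (k : ℝ) ≤ K := by exact_mod_cast (Finset.mem_range.1 hk).le
              gcongr
          _ = K * ((K : ℝ) + 1) ^ s := by simp
          _ ≤ ((K : ℝ) + 1) ^ (s + 1) := by
              rw [pow_succ, mul_comm]
              gcongr
              linarith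
          _ ≤ Y := pow_le_pow_right₀ hK1 (Finset.mem_range.1 hs)
      simpa using Finset.sum_le_sum this
    rw [Finset.sum_range_succ (fun s => ∑ k ∈ Finset.range K, recMass p s k)] at hU
    rw [posExp_succ_eq hp0 hp1]
    rw [abs_le] at hU hB' ⊢
    constructor <;> linarith [hU.1, hU.2, hB'.1, hB'.2]
  · rw [existProb_succ_eq hp0 hp1, sub_sub_cancel, Finset.mul_sum]
    have : 0 ≤ B * Y := by positivity
    have : 0 ≤ t * Y := by positivity
    linarith

lemma eventually_mul_log_pow_le (c : ℝ) (k : ℕ) :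
    ∀ᶠ n : ℕ in atTop, c * Real.log n ^ k ≤ n := by
  have h := ((Real.isLittleO_pow_log_id_atTop (n := k)).const_mul_left c).comp_tendsto
    tendsto_natCast_atTop_atTop
  filter_upwards [h.bound one_pos] with n hn
  simp only [Function.comp_apply, id, one_mul, Real.norm_eq_abs, Nat.abs_cast] at hn
  exact (le_abs_self _).trans hn

end Asymptotics

/-- **Theorem 4 of the paper.**  The average position of the `r`-th weak left-to-right
maximum — the conditional expectation of its position given that the word of length `n`
(i.i.d. geometric(p) letters) has at least `r` weak left-to-right maxima — equals
`(1/(r−1)!) (p log_Q n)^{r−1} + O((log n)^{r−2})` as `n → ∞`, where `q = 1 − p`,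
`Q = 1/q` and `log_Q n = (log n)/(log Q)`. -/
theorem average_position_rth_weak_maximum (r : ℕ) (hr : 1 ≤ r)
    (p : ℝ) (hp0 : 0 < p) (hp1 : p < 1) :
    ∃ C > (0 : ℝ), ∃ N : ℕ, ∀ n ≥ N,
      |(∑' w : Fin n → ℕ,
            (if r ≤ (weakLTRMaxSet w).card then (weakLTRMaxPos w r : ℝ) else 0) *
              wordWt p w) /
          (∑' w : Fin n → ℕ, if r ≤ (weakLTRMaxSet w).card then wordWt p w else 0) -
          (1 / ((r - 1).factorial : ℝ)) *
            (p * (Real.log n / Real.log ((1 - p)⁻¹))) ^ (r - 1)| ≤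
        C * (Real.log n) ^ (r - 2) := by
  obtain ⟨R, rfl⟩ : ∃ R, r = R + 1 := ⟨r - 1, by omega⟩
  have hq : 0 < 1 - p := by linarith
  have hden : ∀ n, (∑' w : Fin n → ℕ,
      if R + 1 ≤ (weakLTRMaxSet w).card then wordWt p w else 0) = existProb p n R := by
    intro n
    refine tsum_congr fun w => ?_
    change _ = (if R + 1 ≤ (weakLTRMaxSet w).card then (1 : ℝ) else 0) * wordWt p w
    rw [ite_mul, one_mul, zero_mul]
  have hnum : ∀ n, (∑' w : Fin n → ℕ,
      (if R + 1 ≤ (weakLTRMaxSet w).card then (weakLTRMaxPos w (R + 1) : ℝ) else 0) *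
        wordWt p w) = posExp p n R := fun _ => rfl
  simp only [hden, hnum, add_tsub_cancel_right]
  cases R with
  | zero =>
    refine ⟨1, one_pos, 1, fun n hn => ?_⟩
    obtain ⟨m, rfl⟩ : ∃ m, n = m + 1 := ⟨n - 1, by omega⟩
    simp [posExp_succ_eq hp0 hp1, existProb_succ_eq hp0 hp1]
  | succ t =>
    obtain ⟨C, hC0, hC⟩ := exists_bound_posExp hp0 hp1 t
    have hQ : 1 < (1 - p)⁻¹ := (one_lt_inv₀ hq).2 (by linarith)
    have hlQ : 0 < Real.log (1 - p)⁻¹ := Real.log_pos hQ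
    set l := Real.log (1 - p)⁻¹ with hl
    set C' := C * (2 / l) ^ t with hC'
    refine ⟨4 * C' + 1, by positivity, ?_⟩
    rw [← Filter.eventually_atTop]
    filter_upwards [eventually_mul_log_pow_le (2 * C') t,
      eventually_mul_log_pow_le (1 / ((t + 1).factorial : ℝ) * (p / l) ^ (t + 1)) (t + 1),
      Filter.eventually_ge_atTop 2, (Real.tendsto_log_atTop.comp
        tendsto_natCast_atTop_atTop).eventually_ge_atTop l] with n hn1 hn2 hn3 hn4
    rw [Function.comp_apply] at hn4
    obtain ⟨m, rfl⟩ : ∃ m, n = m + 1 := ⟨n - 1, by omega⟩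
    set L := Real.log (m + 1 : ℕ) / l with hL
    have hL1 : 1 ≤ L := (one_le_div hlQ).2 hn4
    have hLm : L * l = Real.log (m + 1 : ℕ) := div_mul_cancel₀ _ hlQ.ne'
    have hlogn : 0 ≤ Real.log (m + 1 : ℕ) := hlQ.le.trans hn4
    have hmpos : (0 : ℝ) < (m + 1 : ℕ) := by positivity
    have hK1 : (⌊L⌋₊ : ℝ) ≤ L := Nat.floor_le (by linarith)
    have hK2 : L ≤ (⌊L⌋₊ : ℝ) + 1 := (Nat.lt_floor_add_one L).le
    have hQK1 : ((1 - p)⁻¹) ^ ⌊L⌋₊ ≤ (m : ℝ) + 1 := by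
      rw [← Nat.cast_succ, ← Real.log_le_log_iff (by positivity) hmpos, Real.log_pow, ← hl, ← hLm]
      gcongr
    have hQK2 : (m : ℝ) + 1 ≤ ((1 - p)⁻¹) ^ (⌊L⌋₊ + 1) := by
      rw [← Nat.cast_succ, ← Real.log_le_log_iff hmpos (by positivity), Real.log_pow, ← hl, ← hLm]
      push_cast
      gcongr
    obtain ⟨hb1, hb2⟩ := hC m ⌊L⌋₊ L (by omega) hQK1 hQK2 hK1 hK2
    have hY : C * ((⌊L⌋₊ : ℝ) + 1) ^ t ≤ C' * Real.log (m + 1 : ℕ) ^ t := by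
      rw [hC', mul_assoc, ← mul_pow]
      gcongr
      rw [div_mul_eq_mul_div, mul_div_assoc, ← hL]
      linarith
    have hD1 : existProb p (m + 1) (t + 1) ≤ 1 := by
      rw [existProb_succ_eq hp0 hp1]
      exact sub_le_self _ (Finset.sum_nonneg fun s _ =>
        tsum_nonneg fun k => recProb_nonneg hp0 hp1 m s k)
    have hX : 1 / ((t + 1).factorial : ℝ) * (p * L) ^ (t + 1) ≤ (m + 1 : ℕ) := by
      convert hn2 using 1
      rw [hL, mul_assoc, ← mul_pow]
      congr 2
      ring
    have hfin := abs_div_sub_le hmpos (by positivity) hX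
      (le_of_eq_of_le (by rw [Nat.cast_succ]) (hb2.trans hY)) hD1 (by linarith) (hb1.trans hY)
    refine hfin.trans ?_
    have : 0 ≤ Real.log (m + 1 : ℕ) ^ t := by positivity
    rw [show t + 1 + 1 - 2 = t by omega]
    linarith
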